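/- arXiv:2106.12478 — 2 statements merged into one kernel-verified Lean document; each statement's English description precedes it below -/
import Mathlib

section
/- Let c ≥ 2, let p be a monotone probability vector on c classes, let S be a finite multiset of class labels from {1,…,c}, and let K be the number of elements of S (with multiplicity) not equal to class 1. Let 0 < α ≤ 1 be a real number. If K ≥ log₂(1/α), then ∏_{y ∈ S} p_y ≤ α. -/
/-- If `p` is nonnegative and at most `1` on a multiset `S`, and at most `r` at the elements other
than `a`, then the product of `p` over `S` is at most `r` to the number of those elements. -/
theorem Multiset.prod_map_le_pow_card_filter_ne {ι : Type*} [DecidableEq ι] {p : ι → ℝ} {r : ℝ}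
    (a : ι) (hr : 0 ≤ r) (S : Multiset ι) (h0 : ∀ y ∈ S, 0 ≤ p y) (h1 : p a ≤ 1)
    (hne : ∀ y ∈ S, y ≠ a → p y ≤ r) :
    (S.map p).prod ≤ r ^ (S.filter (· ≠ a)).card := by
  induction S using Multiset.induction_on with
  | empty => simp
  | cons y S ih =>
    have ih' := ih (fun z hz => h0 z (Multiset.mem_cons_of_mem hz))
      (fun z hz => hne z (Multiset.mem_cons_of_mem hz))
    have hy := h0 y (Multiset.mem_cons_self y S)
    have hpow : 0 ≤ r ^ (S.filter (· ≠ a)).card := pow_nonneg hr _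
    rw [Multiset.map_cons, Multiset.prod_cons]
    refine (mul_le_mul_of_nonneg_left ih' hy).trans ?_
    by_cases hya : y = a
    · subst hya
      rw [Multiset.filter_cons_of_neg S (not_not.mpr rfl)]
      exact mul_le_of_le_one_left hpow h1
    · rw [Multiset.filter_cons_of_pos S hya, Multiset.card_cons, pow_succ']
      exact mul_le_mul_of_nonneg_right (hne y (Multiset.mem_cons_self y S) hya) hpow

/-- For a monotone probability vector `p` on `c ≥ 2` classes, a
finite multiset `S` of class labels from `{1, …, c}` with `K` elements (with
multiplicity) not equal to class `1`, and a real `0 < α ≤ 1`: if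
`K ≥ log₂ (1/α)` then `∏_{y ∈ S} p y ≤ α`. -/
theorem matched_responses_prob_le_alpha (c : ℕ) (hc : 2 ≤ c) (p : ℕ → ℝ)
    (h1 : p 1 ≤ 1)
    (hmono : ∀ i j : ℕ, 1 ≤ i → i ≤ j → j ≤ c → p j ≤ p i)
    (hlast : 0 ≤ p c)
    (hsum : ∑ i ∈ Finset.Icc 1 c, p i = 1)
    (S : Multiset ℕ) (hS : ∀ y ∈ S, 1 ≤ y ∧ y ≤ c)
    (K : ℕ) (hK : K = (S.filter (· ≠ 1)).card)
    (α : ℝ) (hα0 : 0 < α) (hα1 : α ≤ 1)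
    (hKα : Real.logb 2 (1 / α) ≤ (K : ℝ)) :
    (S.map p).prod ≤ α := by
  have hnonneg : ∀ i, 1 ≤ i → i ≤ c → 0 ≤ p i := fun i hi hic =>
    hlast.trans (hmono i c hi hic le_rfl)
  have hhalf : ∀ y ∈ S, y ≠ 1 → p y ≤ 1 / 2 := by
    intro y hy hy1
    obtain ⟨hy_pos, hyc⟩ := hS y hy
    have hpair : ∑ i ∈ {1, y}, p i ≤ ∑ i ∈ Finset.Icc 1 c, p i := by
      refine Finset.sum_le_sum_of_subset_of_nonneg ?_ fun i hi _ => ?_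
      · intro i hi
        simp only [Finset.mem_insert, Finset.mem_singleton] at hi
        rw [Finset.mem_Icc]
        omega
      · rw [Finset.mem_Icc] at hi
        exact hnonneg i hi.1 hi.2
    rw [Finset.sum_pair hy1.symm, hsum] at hpair
    linarith [hmono 1 y le_rfl hy_pos hyc]
  have hprod : (S.map p).prod ≤ (1 / 2) ^ K := hK ▸
    Multiset.prod_map_le_pow_card_filter_ne 1 (by norm_num) S
      (fun y hy => hnonneg y (hS y hy).1 (hS y hy).2) h1 hhalf
  rw [Real.logb_le_iff_le_rpow one_lt_two (by positivity), Real.rpow_natCast] at hKα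
  refine hprod.trans ?_
  rw [one_div_pow]
  exact (one_div_le hα0 (by positivity)).mp hKα
end

section
/- Let c ≥ 2, let α be a real number with 0 < α ≤ 1, let S be a finite multiset of class labels from {1,…,c}, let m be a class of maximal multiplicity in S, and let S_support be S with all copies of m removed. If |S_support| ≥ ⌈log₂(1/α)⌉, then |S| ≥ ⌈log₂(1/α)⌉ + ⌈⌈log₂(1/α)⌉ / (c − 1)⌉, where cardinalities of multisets are counted with multiplicity. -/
/-- If `S` has all its elements in `T` and `m ∈ T` has maximal multiplicity among the elements
of `T`, then at most `(#T - 1) * S.count m` elements of `S` differ from `m`. -/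
theorem Multiset.card_filter_ne_le_of_count_le {β : Type*} [DecidableEq β] {S : Multiset β}
    {T : Finset β} {m : β} (hm : m ∈ T) (hS : ∀ y ∈ S, y ∈ T)
    (hmax : ∀ y ∈ T, S.count y ≤ S.count m) :
    Multiset.card (S.filter (· ≠ m)) ≤ (T.card - 1) * S.count m := by
  have hsub : ∀ y ∈ S.filter (· ≠ m), y ∈ T.erase m := fun y hy =>
    Finset.mem_erase.2 ⟨(Multiset.mem_filter.1 hy).2, hS y (Multiset.mem_filter.1 hy).1⟩
  rw [← Multiset.sum_count_eq_card hsub, ← Finset.card_erase_of_mem hm, ← smul_eq_mul]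
  refine Finset.sum_le_card_nsmul _ _ _ fun y hy => ?_
  exact (Multiset.count_le_of_le y (Multiset.filter_le _ S)).trans
    (hmax y (Finset.mem_of_mem_erase hy))

theorem Multiset.card_eq_card_filter_ne_add_count {β : Type*} [DecidableEq β] (S : Multiset β)
    (m : β) : Multiset.card S = Multiset.card (S.filter (· ≠ m)) + S.count m := by
  have h := congrArg Multiset.card (Multiset.filter_add_not (· = m) S)
  rw [Multiset.card_add, Multiset.filter_eq', Multiset.card_replicate] at h
  rw [← h, add_comm]

/-- Equation 12 of the paper: Let `c ≥ 2`, `0 < α ≤ 1`, `S` a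
finite multiset of class labels from `{1, …, c}`, `m` a class of maximal
multiplicity in `S`, and `S_support` the multiset `S` with all copies of `m`
removed. If `|S_support| ≥ ⌈log₂ (1/α)⌉`, then
`|S| ≥ ⌈log₂ (1/α)⌉ + ⌈⌈log₂ (1/α)⌉ / (c - 1)⌉`. -/
theorem matching_set_size_for_rejection (c : ℕ) (hc : 2 ≤ c)
    (α : ℝ) (hα0 : 0 < α) (hα1 : α ≤ 1)
    (S : Multiset ℕ) (hS : ∀ y ∈ S, 1 ≤ y ∧ y ≤ c)
    (m : ℕ) (hm : 1 ≤ m ∧ m ≤ c)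
    (hmmax : ∀ y : ℕ, 1 ≤ y → y ≤ c → S.count y ≤ S.count m)
    (Ssupport : Multiset ℕ) (hsupp : Ssupport = S.filter (· ≠ m))
    (hcard : ⌈Real.logb 2 (1 / α)⌉ ≤ (Multiset.card Ssupport : ℤ)) :
    ⌈Real.logb 2 (1 / α)⌉ + ⌈((⌈Real.logb 2 (1 / α)⌉ : ℝ)) / ((c : ℝ) - 1)⌉ ≤
      (Multiset.card S : ℤ) := by
  have hle := Multiset.card_filter_ne_le_of_count_le (Finset.mem_Icc.2 hm)
    (fun y hy => Finset.mem_Icc.2 (hS y hy))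
    (fun y hy => hmmax y (Finset.mem_Icc.1 hy).1 (Finset.mem_Icc.1 hy).2)
  rw [Nat.card_Icc, Nat.add_sub_cancel, ← hsupp] at hle
  have hsum := Multiset.card_eq_card_filter_ne_add_count S m
  rw [← hsupp] at hsum
  have hc' : (0 : ℝ) < (c : ℝ) - 1 := by
    have : (2 : ℝ) ≤ c := by exact_mod_cast hc
    linarith
  have hceil : ⌈(⌈Real.logb 2 (1 / α)⌉ : ℝ) / ((c : ℝ) - 1)⌉ ≤ (S.count m : ℤ) := by
    rw [Int.ceil_le, div_le_iff₀ hc', Int.cast_natCast]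
    have hcard' : (⌈Real.logb 2 (1 / α)⌉ : ℝ) ≤ Multiset.card Ssupport := by
      exact_mod_cast hcard
    have hle' : (Multiset.card Ssupport : ℝ) ≤ ((c - 1 : ℕ) : ℝ) * S.count m := by
      exact_mod_cast hle
    rw [Nat.cast_sub (by omega), Nat.cast_one] at hle'
    linarith
  omega
end
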